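/- Let V : ℝ^d → [0,∞) be locally integrable and let T be a measurable kernel on (0,∞) × ℝ^d × ℝ^d satisfying: (i) 0 ≤ T_t(x,y) ≤ H_t(x,y); (ii) the perturbation formula H_t(x,y) − T_t(x,y) = ∫₀^t ∫_{ℝ^d} H_{t−s}(x,u) V(u) T_s(u,y) du ds for all t > 0, x,y ∈ ℝ^d. Let Q ⊆ ℝ^d be a cuboid whose half-sides satisfy r_i ≤ C₁ r_j, and suppose there exist σ > 0 and C₀ > 0 such that: (K) sup_{y∈ℝ^d} ∫₀^t ∫_{ℝ^d} H_s(x,y) χ_{Q^{***}}(x) V(x) dx ds ≤ C₀ (t/d_Q²)^σ for all t ≤ d_Q²; and (iii) sup_{y ∈ Q^*} ∫_{ℝ^d ∖ Q^{***}} ∫₀^∞ V(u) T_s(u,y) ds du ≤ C₀. Then for every δ ∈ [0, σ) there is a constant C, depending only on d, σ, δ, C₀, C₁ and κ, such that sup_{y ∈ Q^*} ∫_{Q^{**}} sup_{0<t≤d_Q²} t^{−δ} (H_t(x,y) − T_t(x,y)) dx ≤ C d_Q^{−2δ}. -/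

import Mathlib

open MeasureTheory Set Metric Filter
open scoped ENNReal NNReal

noncomputable section

/-- `ℝ^d` with the Euclidean structure and the Lebesgue measure. -/
abbrev Rd (d : ℕ) := EuclideanSpace ℝ (Fin d)

/-- The cuboid `Q(z, r₁, …, r_d)`, always taken as a subset of `X`. -/
def cuboid {d : ℕ} (X : Set (Rd d)) (z : Rd d) (r : Fin d → ℝ) : Set (Rd d) :=
  {x ∈ X | ∀ i, |x i - z i| ≤ r i}

/-- The `k`-fold enlargement `Q^{*⋯*}` of the cuboid, with enlargement parameter `κ`
(`k = 1` is `Q^*`, `k = 2` is `Q^{**}`, `k = 3` is `Q^{***}`). -/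
def cuboidSt {d : ℕ} (X : Set (Rd d)) (z : Rd d) (r : Fin d → ℝ) (κ : ℝ) (k : ℕ) :
    Set (Rd d) :=
  cuboid X z fun i => κ ^ k * r i

/-- The classical heat kernel `H_t(x,y) = (4πt)^{-d/2} exp(-|x-y|²/(4t))` on `ℝ^d`. -/
def heatK (d : ℕ) (t : ℝ) (x y : Rd d) : ℝ :=
  (4 * Real.pi * t) ^ (-(d : ℝ) / 2) * Real.exp (-dist x y ^ 2 / (4 * t))

/-- The heat kernel as an extended nonnegative real. -/
def heatE (d : ℕ) (t : ℝ) (x y : Rd d) : ℝ≥0∞ := ENNReal.ofReal (heatK d t x y)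

theorem heatK_nonneg (d : ℕ) {t : ℝ} (ht : 0 ≤ t) (x y : Rd d) : 0 ≤ heatK d t x y := by
  unfold heatK; positivity

@[fun_prop]
theorem Measurable.heatE {α : Type*} [MeasurableSpace α] {d : ℕ} {f : α → ℝ} {g h : α → Rd d}
    (hf : Measurable f) (hg : Measurable g) (hh : Measurable h) :
    Measurable fun a => heatE d (f a) (g a) (h a) := by
  unfold _root_.heatE heatK
  fun_prop

theorem heatK_zero {d : ℕ} (hd : 0 < d) (x y : Rd d) : heatK d 0 x y = 0 := by
  have : -(d : ℝ) / 2 ≠ 0 := by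
    have : (0 : ℝ) < d := by exact_mod_cast hd
    intro h; linarith
  simp [heatK, Real.zero_rpow this]

theorem lintegral_heatE (d : ℕ) {t : ℝ} (ht : 0 < t) (u : Rd d) :
    ∫⁻ x, heatE d t x u = 1 := by
  have hb : (0 : ℝ) < 1 / (4 * t) := by positivity
  have key := GaussianFourier.integral_rexp_neg_mul_sq_norm (V := Rd d) hb
  have hint : Integrable (fun v : Rd d => Real.exp (-(1 / (4 * t)) * ‖v‖ ^ 2)) := by
    by_contra h
    rw [integral_undef h] at key
    have : (0 : ℝ) < (Real.pi / (1 / (4 * t))) ^ (Module.finrank ℝ (Rd d) / 2 : ℝ) := by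
      positivity
    linarith
  have h1 : ∫⁻ x, heatE d t x u = ∫⁻ v : Rd d, ENNReal.ofReal
      ((4 * Real.pi * t) ^ (-(d : ℝ) / 2) * Real.exp (-(1 / (4 * t)) * ‖v‖ ^ 2)) := by
    rw [← lintegral_sub_right_eq_self (fun v : Rd d => ENNReal.ofReal
      ((4 * Real.pi * t) ^ (-(d : ℝ) / 2) * Real.exp (-(1 / (4 * t)) * ‖v‖ ^ 2))) u]
    refine lintegral_congr fun x => ?_
    rw [heatE, heatK, dist_eq_norm]
    congr 3
    ring
  rw [h1, ← ofReal_integral_eq_lintegral_ofReal (hint.const_mul _)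
    (Eventually.of_forall fun v => by positivity), integral_const_mul, key]
  have : Real.pi / (1 / (4 * t)) = 4 * Real.pi * t := by field_simp
  rw [this, finrank_euclideanSpace, Fintype.card_fin, ← Real.rpow_add (by positivity)]
  ring_nf
  simp

theorem heatE_le_of_le {d : ℕ} {s a : ℝ} (hs : 0 < s) (hsa : s ≤ a) (ha : a ≤ 4 * s)
    (x y : Rd d) : heatE d s x y ≤ 2 ^ d * heatE d a x y := by
  have h2 : (2 : ℝ≥0∞) ^ d = ENNReal.ofReal (2 ^ d) := by
    rw [ENNReal.ofReal_pow (by norm_num)]; norm_num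
  rw [heatE, heatE, h2, ← ENNReal.ofReal_mul (by positivity)]
  refine ENNReal.ofReal_le_ofReal ?_
  rw [heatK, heatK, ← mul_assoc]
  have hpi := Real.pi_pos
  have ha0 : 0 < a := hs.trans_le hsa
  have h4 : (2 : ℝ) ^ d = (4 : ℝ) ^ ((d : ℝ) / 2) := by
    rw [show (4 : ℝ) = 2 ^ (2 : ℝ) by norm_num, ← Real.rpow_mul (by norm_num),
      ← Real.rpow_natCast]
    congr 1; ring
  rw [neg_div (4 * s), neg_div (4 * a)]
  gcongr
  rw [h4, show -(d : ℝ) / 2 = -((d : ℝ) / 2) by ring, Real.rpow_neg (by positivity),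
    Real.rpow_neg (by positivity), ← Real.inv_rpow (by positivity),
    ← Real.inv_rpow (by positivity), ← Real.mul_rpow (by positivity) (by positivity)]
  refine Real.rpow_le_rpow (by positivity) ?_ (by positivity)
  rw [inv_le_iff_one_le_mul₀ (by positivity)]
  rw [show 4 * (4 * Real.pi * a)⁻¹ * (4 * Real.pi * s) = 4 * s / a by field_simp]
  rwa [one_le_div ha0]

theorem heatE_le_of_dist_le {d : ℕ} {s a M : ℝ} (ha : 0 < a) (has : a ≤ s) {x y : Rd d}
    (h : dist x y ^ 2 ≤ 4 * a * M) :
    heatE d s x y ≤ ENNReal.ofReal (Real.exp M) * heatE d a x y := by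
  rw [heatE, heatE, ← ENNReal.ofReal_mul (by positivity)]
  refine ENNReal.ofReal_le_ofReal ?_
  have hpi := Real.pi_pos
  have hs : 0 < s := ha.trans_le has
  rw [heatK, heatK, mul_left_comm, ← Real.exp_add]
  have h1 : (4 * Real.pi * s) ^ (-(d : ℝ) / 2) ≤ (4 * Real.pi * a) ^ (-(d : ℝ) / 2) := by
    refine Real.rpow_le_rpow_of_nonpos (by positivity) (by gcongr) ?_
    have : (0 : ℝ) ≤ d := by positivity
    linarith
  refine mul_le_mul h1 (Real.exp_le_exp.2 ?_) (by positivity) (by positivity)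
  have h2 : dist x y ^ 2 / (4 * a) ≤ M := by
    rw [div_le_iff₀ (by positivity)]; linarith
  have h3 : 0 ≤ dist x y ^ 2 / (4 * s) := by positivity
  rw [neg_div, neg_div]
  linarith

/-- The Kato-type condition in integrated form controls single time slices. -/
theorem mul_lintegral_heatE_le {d : ℕ} {σ C₀ M D : ℝ} (hC₀ : 0 < C₀) (hD : 0 < D)
    (ν : Measure (Rd d)) (y : Rd d) (hdist : ∀ᵐ u ∂ν, dist u y ≤ M * D)
    (hK : ∀ t ∈ Ioc 0 (D ^ 2), ∫⁻ s in Ioc 0 t, ∫⁻ u, heatE d s u y ∂ν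
      ≤ ENNReal.ofReal (C₀ * (t / D ^ 2) ^ σ)) {t : ℝ} (ht : 0 < t) (htD : t ≤ D ^ 2) :
    ENNReal.ofReal t * ∫⁻ u, heatE d t u y ∂ν ≤
      ENNReal.ofReal ((2 ^ d * 2 ^ σ + 2 * Real.exp (M ^ 2)) * C₀ * (t / D ^ 2) ^ σ) := by
  have hD2 : 0 < D ^ 2 := by positivity
  have slice : ∀ (c : ℝ) (p q : ℝ), 0 ≤ c → 0 ≤ p → q ∈ Ioc 0 (D ^ 2) →
      (∀ s ∈ Ioc p q, ∫⁻ u, heatE d t u y ∂ν ≤ ENNReal.ofReal c * ∫⁻ u, heatE d s u y ∂ν) →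
      ENNReal.ofReal (q - p) * ∫⁻ u, heatE d t u y ∂ν
        ≤ ENNReal.ofReal (c * (C₀ * (q / D ^ 2) ^ σ)) := by
    intro c p q hc hp hq h
    calc ENNReal.ofReal (q - p) * ∫⁻ u, heatE d t u y ∂ν
        = ∫⁻ _s in Ioc p q, ∫⁻ u, heatE d t u y ∂ν := by
          rw [setLIntegral_const, Real.volume_Ioc, mul_comm]
      _ ≤ ∫⁻ s in Ioc p q, ENNReal.ofReal c * ∫⁻ u, heatE d s u y ∂ν :=
          setLIntegral_mono' measurableSet_Ioc h
      _ ≤ ∫⁻ s in Ioc 0 q, ENNReal.ofReal c * ∫⁻ u, heatE d s u y ∂ν :=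
          lintegral_mono_set (Ioc_subset_Ioc_left hp)
      _ = ENNReal.ofReal c * ∫⁻ s in Ioc 0 q, ∫⁻ u, heatE d s u y ∂ν :=
          lintegral_const_mul' _ _ ENNReal.ofReal_ne_top
      _ ≤ ENNReal.ofReal c * ENNReal.ofReal (C₀ * (q / D ^ 2) ^ σ) := by
          gcongr; exact hK q hq
      _ = _ := (ENNReal.ofReal_mul hc).symm
  have hpos : 0 ≤ (t / D ^ 2) ^ σ := by positivity
  have he := Real.exp_pos (M ^ 2)
  rcases le_or_gt (2 * t) (D ^ 2) with h | h
  · have := slice (2 ^ d) t (2 * t) (by positivity) ht.le ⟨by linarith, h⟩ fun s hs => by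
      rw [← lintegral_const_mul' _ _ ENNReal.ofReal_ne_top]
      refine lintegral_mono fun u => ?_
      have := heatE_le_of_le ht hs.1.le (by linarith [hs.2]) u y
      rwa [ENNReal.ofReal_pow (by norm_num), ENNReal.ofReal_ofNat]
    rw [show 2 * t - t = t by ring] at this
    refine this.trans (ENNReal.ofReal_le_ofReal ?_)
    rw [mul_div_assoc, Real.mul_rpow (by norm_num) (by positivity)]
    have : 0 ≤ Real.exp (M ^ 2) * C₀ * (t / D ^ 2) ^ σ := by positivity
    nlinarith
  · have := slice (Real.exp (M ^ 2)) (t / 2) t (by positivity) (by positivity) ⟨ht, htD⟩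
      fun s hs => by
      rw [← lintegral_const_mul' _ _ ENNReal.ofReal_ne_top]
      refine lintegral_mono_ae ?_
      filter_upwards [hdist] with u hu
      refine heatE_le_of_dist_le (by linarith [hs.1]) hs.2 ?_
      calc dist u y ^ 2 ≤ (M * D) ^ 2 := by gcongr
        _ = D ^ 2 * M ^ 2 := by ring
        _ ≤ 4 * s * M ^ 2 := by gcongr; linarith [hs.1]
    rw [show ENNReal.ofReal t = ENNReal.ofReal 2 * ENNReal.ofReal (t - t / 2) by
      rw [← ENNReal.ofReal_mul (by norm_num)]; congr 1; ring, mul_assoc]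
    refine (mul_le_mul_right this _).trans ?_
    rw [← ENNReal.ofReal_mul (by norm_num)]
    refine ENNReal.ofReal_le_ofReal ?_
    have : 0 ≤ 2 ^ d * 2 ^ σ * C₀ * (t / D ^ 2) ^ σ := by positivity
    nlinarith

theorem setLIntegral_Ioc_sub_left (f : ℝ → ℝ≥0∞) (t : ℝ) :
    ∫⁻ s in Ioc 0 t, f (t - s) = ∫⁻ s in Ioc 0 t, f s := by
  rw [← restrict_Ioo_eq_restrict_Ioc, ← lintegral_indicator measurableSet_Ioo,
    ← lintegral_indicator measurableSet_Ioo, ← lintegral_sub_left_eq_self _ t]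
  refine lintegral_congr fun s => ?_
  simp only [indicator, mem_Ioo, sub_pos, sub_lt_self_iff, sub_sub_cancel]
  simp only [and_comm]

/-- On a dyadic block of times, one of the two heat kernels in the Duhamel integral can be frozen
at the endpoint of the block. -/
theorem duhamel_le_frozen {d : ℕ} (ν : Measure (Rd d)) [SFinite ν] (x y : Rd d) {a t : ℝ}
    (ha : 0 < a) (hat : a / 2 < t) (hta : t ≤ a) :
    ∫⁻ s in Ioc 0 t, ∫⁻ u, heatE d (t - s) x u * heatE d s u y ∂ν ≤
      2 ^ d * ((∫⁻ s in Ioc 0 a, ∫⁻ u, heatE d a x u * heatE d s u y ∂ν) +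
        ∫⁻ s in Ioc 0 a, ∫⁻ u, heatE d s x u * heatE d a u y ∂ν) := by
  have h2 : (2 : ℝ≥0∞) ^ d ≠ ∞ := by finiteness
  calc ∫⁻ s in Ioc 0 t, ∫⁻ u, heatE d (t - s) x u * heatE d s u y ∂ν
      ≤ ∫⁻ s in Ioc 0 t, ∫⁻ u, 2 ^ d *
          (heatE d a x u * heatE d s u y + heatE d (t - s) x u * heatE d a u y) ∂ν := by
        refine setLIntegral_mono' measurableSet_Ioc fun s hs => lintegral_mono fun u => ?_
        rw [mul_add]
        rcases le_or_gt s (t / 2) with h | h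
        · refine le_add_right ?_
          rw [← mul_assoc]
          gcongr
          exact heatE_le_of_le (by linarith [hs.1]) (by linarith [hs.1]) (by linarith) x u
        · refine le_add_left ?_
          rw [mul_left_comm]
          gcongr
          exact heatE_le_of_le (by linarith [hs.1]) (by linarith [hs.2]) (by linarith) u y
    _ = 2 ^ d * ((∫⁻ s in Ioc 0 t, ∫⁻ u, heatE d a x u * heatE d s u y ∂ν) +
          ∫⁻ s in Ioc 0 t, ∫⁻ u, heatE d (t - s) x u * heatE d a u y ∂ν) := by
        rw [← lintegral_add_left (Measurable.lintegral_prod_right' (f := fun p : ℝ × Rd d =>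
          heatE d a x p.2 * heatE d p.1 p.2 y) (by fun_prop)), ← lintegral_const_mul' _ _ h2]
        refine lintegral_congr fun s => ?_
        rw [lintegral_const_mul' _ _ h2, lintegral_add_left (by fun_prop)]
    _ = 2 ^ d * ((∫⁻ s in Ioc 0 t, ∫⁻ u, heatE d a x u * heatE d s u y ∂ν) +
          ∫⁻ s in Ioc 0 t, ∫⁻ u, heatE d s x u * heatE d a u y ∂ν) := by
        rw [setLIntegral_Ioc_sub_left (fun s => ∫⁻ u, heatE d s x u * heatE d a u y ∂ν) t]
    _ ≤ _ := by
        gcongr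

theorem lintegral_frozen_left {d : ℕ} (ν : Measure (Rd d)) [SFinite ν] (y : Rd d) {a : ℝ}
    (ha : 0 < a) :
    ∫⁻ x, ∫⁻ s in Ioc 0 a, ∫⁻ u, heatE d a x u * heatE d s u y ∂ν =
      ∫⁻ s in Ioc 0 a, ∫⁻ u, heatE d s u y ∂ν := by
  rw [lintegral_lintegral_swap (Measurable.aemeasurable (Measurable.lintegral_prod_right'
    (f := fun p : (Rd d × ℝ) × Rd d => heatE d a p.1.1 p.2 * heatE d p.1.2 p.2 y)
    (by fun_prop)))]
  refine lintegral_congr fun s => ?_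
  rw [lintegral_lintegral_swap (by fun_prop)]
  refine lintegral_congr fun u => ?_
  rw [lintegral_mul_const _ (by fun_prop), lintegral_heatE d ha, one_mul]

theorem lintegral_frozen_right {d : ℕ} (ν : Measure (Rd d)) [SFinite ν] (y : Rd d) (a : ℝ) :
    ∫⁻ x, ∫⁻ s in Ioc 0 a, ∫⁻ u, heatE d s x u * heatE d a u y ∂ν =
      ENNReal.ofReal a * ∫⁻ u, heatE d a u y ∂ν := by
  rw [lintegral_lintegral_swap (Measurable.aemeasurable (Measurable.lintegral_prod_right'
    (f := fun p : (Rd d × ℝ) × Rd d => heatE d p.1.2 p.1.1 p.2 * heatE d a p.2 y)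
    (by fun_prop)))]
  have : ∀ s ∈ Ioc 0 a, ∫⁻ x, ∫⁻ u, heatE d s x u * heatE d a u y ∂ν =
      ∫⁻ u, heatE d a u y ∂ν := fun s hs => by
    rw [lintegral_lintegral_swap (by fun_prop)]
    refine lintegral_congr fun u => ?_
    rw [lintegral_mul_const _ (by fun_prop), lintegral_heatE d hs.1, one_mul]
  rw [setLIntegral_congr_fun measurableSet_Ioc this, setLIntegral_const, Real.volume_Ioc,
    sub_zero, mul_comm]

/-- The maximal function of the Duhamel integral of a measure satisfying the Kato-type
condition is dominated by an integrable function. -/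
theorem exists_duhamel_majorant (d : ℕ) {σ δ C₀ : ℝ} (M : ℝ) (hδ : 0 ≤ δ)
    (hδσ : δ < σ) (hC₀ : 0 < C₀) :
    ∃ C > 0, ∀ (D : ℝ) (ν : Measure (Rd d)) [SFinite ν] (y : Rd d), 0 < D →
      (∀ᵐ u ∂ν, dist u y ≤ M * D) →
      (∀ t ∈ Ioc 0 (D ^ 2), ∫⁻ s in Ioc 0 t, ∫⁻ u, heatE d s u y ∂ν
        ≤ ENNReal.ofReal (C₀ * (t / D ^ 2) ^ σ)) →
      ∃ F : Rd d → ℝ≥0∞, Measurable F ∧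
        (∀ x, ∀ t ∈ Ioc 0 (D ^ 2), ENNReal.ofReal (t ^ (-δ)) *
          ∫⁻ s in Ioc 0 t, ∫⁻ u, heatE d (t - s) x u * heatE d s u y ∂ν ≤ F x) ∧
        ∫⁻ x, F x ≤ ENNReal.ofReal (C * D ^ (-(2 * δ))) := by
  set q : ℝ := (1 / 2) ^ (σ - δ) with hq
  have hq0 : 0 ≤ q := by positivity
  have hq1 : q < 1 := Real.rpow_lt_one (by norm_num) (by norm_num) (by linarith)
  set A : ℝ := (1 + (2 ^ d * 2 ^ σ + 2 * Real.exp (M ^ 2))) * C₀ with hA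
  have hA0 : 0 < A := by positivity
  have hq1' : 0 < 1 - q := by linarith
  refine ⟨2 ^ δ * 2 ^ d * A * (1 - q)⁻¹, by positivity, fun D ν _ y hD hdist hK => ?_⟩
  have hD2 : 0 < D ^ 2 := by positivity
  let a : ℕ → ℝ := fun j => (1 / 2) ^ j * D ^ 2
  have ha0 : ∀ j, 0 < a j := fun j => by positivity
  have haD : ∀ j, a j ≤ D ^ 2 := fun j =>
    mul_le_of_le_one_left hD2.le (pow_le_one₀ (by norm_num) (by norm_num))
  let F : ℕ → Rd d → ℝ≥0∞ := fun j x => ENNReal.ofReal ((a j / 2) ^ (-δ)) *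
    (2 ^ d * ((∫⁻ s in Ioc 0 (a j), ∫⁻ u, heatE d (a j) x u * heatE d s u y ∂ν) +
        ∫⁻ s in Ioc 0 (a j), ∫⁻ u, heatE d s x u * heatE d (a j) u y ∂ν))
  have hmL : ∀ j, Measurable fun x : Rd d =>
      ∫⁻ s in Ioc 0 (a j), ∫⁻ u, heatE d (a j) x u * heatE d s u y ∂ν := fun j =>
    Measurable.lintegral_prod_right' (f := fun p : Rd d × ℝ =>
      ∫⁻ u, heatE d (a j) p.1 u * heatE d p.2 u y ∂ν) (Measurable.lintegral_prod_right'
        (f := fun p : (Rd d × ℝ) × Rd d => heatE d (a j) p.1.1 p.2 * heatE d p.1.2 p.2 y)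
        (by fun_prop))
  have hmR : ∀ j, Measurable fun x : Rd d =>
      ∫⁻ s in Ioc 0 (a j), ∫⁻ u, heatE d s x u * heatE d (a j) u y ∂ν := fun j =>
    Measurable.lintegral_prod_right' (f := fun p : Rd d × ℝ =>
      ∫⁻ u, heatE d p.2 p.1 u * heatE d (a j) u y ∂ν) (Measurable.lintegral_prod_right'
        (f := fun p : (Rd d × ℝ) × Rd d => heatE d p.1.2 p.1.1 p.2 * heatE d (a j) p.2 y)
        (by fun_prop))
  have hmF : ∀ j, Measurable (F j) := fun j =>
    (((hmL j).add (hmR j)).const_mul _).const_mul _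
  refine ⟨fun x => ∑' j, F j x, Measurable.tsum hmF, fun x t ht => ?_, ?_⟩
  · obtain ⟨j, hj1, hj2⟩ := exists_nat_pow_near_of_lt_one (x := t / D ^ 2) (y := (1 / 2 : ℝ))
      (div_pos ht.1 hD2) ((div_le_one hD2).2 ht.2) (by norm_num) (by norm_num)
    rw [lt_div_iff₀ hD2] at hj1
    rw [div_le_iff₀ hD2] at hj2
    have hj1' : a j / 2 < t := by
      refine lt_of_eq_of_lt ?_ hj1
      simp only [a]; ring
    refine le_trans ?_ (ENNReal.le_tsum j)
    refine mul_le_mul' (ENNReal.ofReal_le_ofReal ?_)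
      (duhamel_le_frozen ν x y (ha0 j) hj1' hj2)
    exact Real.rpow_le_rpow_of_nonpos (by have := ha0 j; positivity) hj1'.le (by linarith)
  · rw [lintegral_tsum fun j => (hmF j).aemeasurable]
    have hF : ∀ j, ∫⁻ x, F j x ≤
        ENNReal.ofReal (2 ^ δ * 2 ^ d * A * D ^ (-(2 * δ)) * q ^ j) := fun j => by
      have hj := ha0 j
      simp only [F]
      rw [lintegral_const_mul' _ _ ENNReal.ofReal_ne_top,
        lintegral_const_mul' _ _ (by finiteness), lintegral_add_left (hmL j),
        lintegral_frozen_left ν y hj, lintegral_frozen_right]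
      have h1 := hK (a j) ⟨hj, haD j⟩
      have h2 := mul_lintegral_heatE_le hC₀ hD ν y hdist hK hj (haD j)
      calc _ ≤ ENNReal.ofReal ((a j / 2) ^ (-δ)) * (ENNReal.ofReal (2 ^ d) *
            (ENNReal.ofReal (C₀ * (a j / D ^ 2) ^ σ) + ENNReal.ofReal
              ((2 ^ d * 2 ^ σ + 2 * Real.exp (M ^ 2)) * C₀ * (a j / D ^ 2) ^ σ))) := by
            rw [ENNReal.ofReal_pow (by norm_num), ENNReal.ofReal_ofNat]
            gcongr
        _ = ENNReal.ofReal ((a j / 2) ^ (-δ) * (2 ^ d * (A * (a j / D ^ 2) ^ σ))) := by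
            rw [← ENNReal.ofReal_add (by positivity) (by positivity),
              ← ENNReal.ofReal_mul (by positivity), ← ENNReal.ofReal_mul (by positivity), hA]
            congr 3; ring
        _ = _ := by
            congr 1
            have e1 : (a j / D ^ 2) ^ σ = ((1 / 2 : ℝ) ^ σ) ^ j := by
              simp only [a]
              rw [mul_div_cancel_right₀ _ hD2.ne', ← Real.rpow_natCast,
                ← Real.rpow_mul (by norm_num), ← Real.rpow_natCast,
                ← Real.rpow_mul (by norm_num), mul_comm]
            have e2 : (a j / 2) ^ (-δ) = 2 ^ δ * ((1 / 2 : ℝ) ^ (-δ)) ^ j * D ^ (-(2 * δ)) := by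
              simp only [a]
              rw [div_eq_mul_inv, Real.mul_rpow (by positivity) (by positivity),
                Real.mul_rpow (by positivity) (by positivity),
                Real.inv_rpow (by norm_num), Real.rpow_neg (by norm_num : (0:ℝ) ≤ 2), inv_inv,
                show -(2 * δ) = 2 * (-δ) by ring, Real.rpow_mul hD.le, Real.rpow_two,
                ← Real.rpow_natCast (1 / 2) j, ← Real.rpow_natCast ((1 / 2 : ℝ) ^ (-δ)) j,
                ← Real.rpow_mul (by norm_num), ← Real.rpow_mul (by norm_num), mul_comm (j : ℝ)]
              ring
            rw [e1, e2, hq, sub_eq_add_neg, Real.rpow_add (by norm_num), mul_pow]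
            ring
    calc ∑' j, ∫⁻ x, F j x
        ≤ ∑' j, ENNReal.ofReal (2 ^ δ * 2 ^ d * A * D ^ (-(2 * δ)) * q ^ j) :=
          ENNReal.tsum_le_tsum hF
      _ = ENNReal.ofReal (∑' j, 2 ^ δ * 2 ^ d * A * D ^ (-(2 * δ)) * q ^ j) :=
          (ENNReal.ofReal_tsum_of_nonneg (fun j => by positivity)
            ((summable_geometric_of_lt_one hq0 hq1).mul_left _)).symm
      _ = _ := by
          rw [tsum_mul_left, tsum_geometric_of_lt_one hq0 hq1]
          congr 1; ring

theorem exists_heatK_off_diagonal_bound {d : ℕ} (hd : 0 < d) {δ c : ℝ} (hδ : 0 ≤ δ)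
    (hc : 0 < c) :
    ∃ K > 0, ∀ (D t s : ℝ) (x u : Rd d), 0 < D → 0 < t → s ∈ Ioc 0 t → c * D ≤ dist x u →
      t ^ (-δ) * heatK d (t - s) x u ≤ K * D ^ (-(2 * δ) - d) := by
  have hd' : (0 : ℝ) < d := by exact_mod_cast hd
  set p : ℝ := δ + d / 2 with hp
  have hp0 : 0 < p := by positivity
  refine ⟨(c ^ 2 / (4 * p)) ^ (-p), by positivity, fun D t s x u hD ht hs hdist => ?_⟩
  rcases hs.2.eq_or_lt with rfl | hst
  · rw [sub_self, heatK_zero hd, mul_zero]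
    positivity
  set w := t - s with hw
  have hw0 : 0 < w := by linarith
  have hpi := Real.pi_gt_three
  have h1 : t ^ (-δ) ≤ w ^ (-δ) :=
    Real.rpow_le_rpow_of_nonpos hw0 (by linarith [hs.1]) (by linarith)
  have h2 : (4 * Real.pi * w) ^ (-(d : ℝ) / 2) ≤ w ^ (-(d : ℝ) / 2) :=
    Real.rpow_le_rpow_of_nonpos hw0 (by nlinarith) (by linarith)
  set X : ℝ := (c * D) ^ 2 / (4 * w * p) with hX
  have hX0 : 0 < X := by positivity
  have h3 : Real.exp (-dist x u ^ 2 / (4 * w)) ≤ X ^ (-p) := by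
    have hXp : X ^ p ≤ Real.exp (X * p) := by
      rw [Real.exp_mul]
      exact Real.rpow_le_rpow hX0.le (by linarith [Real.add_one_le_exp X]) hp0.le
    rw [Real.rpow_neg hX0.le, neg_div, Real.exp_neg]
    refine inv_anti₀ (by positivity) (hXp.trans (Real.exp_le_exp.2 ?_))
    rw [hX, show (c * D) ^ 2 / (4 * w * p) * p = (c * D) ^ 2 / (4 * w) by field_simp]
    gcongr
  calc t ^ (-δ) * heatK d w x u
      ≤ w ^ (-δ) * (w ^ (-(d : ℝ) / 2) * X ^ (-p)) := by
        unfold heatK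
        gcongr
    _ = (w * X) ^ (-p) := by
        rw [← mul_assoc, ← Real.rpow_add hw0, Real.mul_rpow hw0.le hX0.le, hp]
        ring_nf
    _ = (c ^ 2 / (4 * p) * D ^ 2) ^ (-p) := by
        congr 1
        rw [hX]
        field_simp
    _ = (c ^ 2 / (4 * p)) ^ (-p) * D ^ (-(2 * δ) - d) := by
        rw [Real.mul_rpow (by positivity) (by positivity), ← Real.rpow_two D, ← Real.rpow_mul hD.le,
          hp]
        ring_nf

theorem dist_le_card_mul {d : ℕ} {x y : Rd d} {m : ℝ} (hm : 0 ≤ m)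
    (h : ∀ i, |x i - y i| ≤ m) : dist x y ≤ d * m := by
  rw [EuclideanSpace.dist_eq]
  refine Real.sqrt_le_iff.2 ⟨by positivity, ?_⟩
  have hd : (d : ℝ) ≤ d ^ 2 := by exact_mod_cast Nat.le_self_pow two_ne_zero d
  calc ∑ i, dist (x i) (y i) ^ 2 ≤ ∑ _i : Fin d, m ^ 2 := by
        refine Finset.sum_le_sum fun i _ => ?_
        rw [Real.dist_eq]
        gcongr
        exact h i
    _ = d * m ^ 2 := by simp
    _ ≤ (d * m) ^ 2 := by rw [mul_pow]; gcongr

theorem abs_coord_sub_le_dist {d : ℕ} (x y : Rd d) (i : Fin d) : |x i - y i| ≤ dist x y := by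
  rw [dist_eq_norm]
  exact PiLp.norm_apply_le (x - y) i

theorem abs_coord_sub_le_add {d : ℕ} {z x y : Rd d} {i : Fin d} {p q : ℝ}
    (hx : |x i - z i| ≤ p) (hy : |y i - z i| ≤ q) : |x i - y i| ≤ p + q := by
  have := abs_sub_le (x i) (z i) (y i)
  rw [abs_sub_comm (z i)] at this
  linarith

theorem measurableSet_cuboid {d : ℕ} (z : Rd d) (r : Fin d → ℝ) :
    MeasurableSet (cuboid univ z r) := by
  have : cuboid univ z r = ⋂ i, {x : Rd d | |x i - z i| ≤ r i} := by
    ext x; simp [cuboid]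
  rw [this]
  refine MeasurableSet.iInter fun i => measurableSet_le ?_ measurable_const
  fun_prop

theorem isBounded_cuboid {d : ℕ} (z : Rd d) (r : Fin d → ℝ) :
    Bornology.IsBounded (cuboid univ z r) := by
  refine (isBounded_closedBall (x := z) (r := d * ∑ i, |r i|)).subset fun x hx => ?_
  refine dist_le_card_mul (Finset.sum_nonneg fun i _ => abs_nonneg _) fun i => ?_
  exact ((hx.2 i).trans (le_abs_self _)).trans
    (Finset.single_le_sum (f := fun i => |r i|) (fun i _ => abs_nonneg _) (Finset.mem_univ i))

theorem side_le_diam_cuboid {d : ℕ} (z : Rd d) {r : Fin d → ℝ} (hr : ∀ i, 0 < r i) (i : Fin d) :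
    r i ≤ diam (cuboid univ z r) := by
  have h1 : z ∈ cuboid univ z r := ⟨mem_univ _, fun j => by simpa using (hr j).le⟩
  have h2 : z + EuclideanSpace.single i (r i) ∈ cuboid univ z r := ⟨mem_univ _, fun j => by
    by_cases h : j = i
    · subst h; simp [abs_of_pos (hr j)]
    · simp [h, (hr j).le]⟩
  have h3 := dist_le_diam_of_mem (isBounded_cuboid z r) h1 h2
  simpa [abs_of_pos (hr i)] using h3

theorem diam_cuboid_le {d : ℕ} (z : Rd d) {r : Fin d → ℝ} {C₁ : ℝ} (hC₁ : 0 < C₁)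
    (hr : ∀ i, 0 < r i) (hrC : ∀ i j, r i ≤ C₁ * r j) (i : Fin d) :
    diam (cuboid univ z r) ≤ 2 * d * C₁ * r i := by
  have hi := hr i
  refine diam_le_of_forall_dist_le (by positivity) fun x hx y hy => ?_
  refine (dist_le_card_mul (m := C₁ * r i + C₁ * r i) (by positivity) fun j => ?_).trans_eq
    (by ring)
  exact abs_coord_sub_le_add ((hx.2 j).trans (hrC j i)) ((hy.2 j).trans (hrC j i))

theorem le_dist_of_notMem_cuboidSt {d : ℕ} {z : Rd d} {r : Fin d → ℝ} {C₁ κ : ℝ} (hC₁ : 0 < C₁)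
    (hκ : 1 < κ) (hr : ∀ i, 0 < r i) (hrC : ∀ i j, r i ≤ C₁ * r j) {x u : Rd d}
    (hx : x ∈ cuboidSt univ z r κ 2) (hu : u ∉ cuboidSt univ z r κ 3) :
    (κ ^ 3 - κ ^ 2) / (2 * d * C₁) * diam (cuboid univ z r) ≤ dist x u := by
  have : ∃ i, κ ^ 3 * r i < |u i - z i| := by
    by_contra! h
    exact hu ⟨mem_univ _, h⟩
  obtain ⟨i, hi⟩ := this
  have hκ' : 0 ≤ κ ^ 3 - κ ^ 2 := by
    have := pow_le_pow_right₀ hκ.le (show 2 ≤ 3 by norm_num)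
    linarith
  have hd : (0 : ℝ) < d := by exact_mod_cast i.pos
  calc (κ ^ 3 - κ ^ 2) / (2 * d * C₁) * diam (cuboid univ z r)
      ≤ (κ ^ 3 - κ ^ 2) / (2 * d * C₁) * (2 * d * C₁ * r i) := by
        gcongr
        exact diam_cuboid_le z hC₁ hr hrC i
    _ = κ ^ 3 * r i - κ ^ 2 * r i := by field_simp
    _ ≤ |u i - z i| - |x i - z i| := by
        have : |x i - z i| ≤ κ ^ 2 * r i := hx.2 i
        linarith
    _ ≤ |x i - u i| := by
        rw [abs_sub_comm (x i) (u i)]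
        have := abs_sub_abs_le_abs_sub (u i - z i) (x i - z i)
        rwa [sub_sub_sub_cancel_right] at this
    _ ≤ dist x u := abs_coord_sub_le_dist x u i

theorem ofReal_integral_integral_le {α β : Type*} [MeasurableSpace α] [MeasurableSpace β]
    (μ : Measure α) (ν : Measure β) (f : α → β → ℝ) :
    ENNReal.ofReal (∫ a, ∫ b, f a b ∂ν ∂μ) ≤ ∫⁻ a, ∫⁻ b, ‖f a b‖ₑ ∂ν ∂μ :=
  calc ENNReal.ofReal (∫ a, ∫ b, f a b ∂ν ∂μ) ≤ ‖∫ a, ∫ b, f a b ∂ν ∂μ‖ₑ :=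
        Real.ofReal_le_enorm _
    _ ≤ ∫⁻ a, ‖∫ b, f a b ∂ν‖ₑ ∂μ := enorm_integral_le_lintegral_enorm _
    _ ≤ _ := lintegral_mono fun _ => enorm_integral_le_lintegral_enorm _

/-- (A₂)-type estimate for Schrödinger semigroups: if `0 ≤ T_t ≤ H_t`,
the perturbation formula holds with a nonnegative locally integrable potential `V`, the
cuboid `Q` satisfies condition (K) with exponent `σ`, and the tail estimate (iii) holds, then
for every `δ ∈ [0, σ)`,
`sup_{y∈Q^*} ∫_{Q^{**}} sup_{0<t≤d_Q²} t^{−δ} (H_t(x,y) − T_t(x,y)) dx ≤ C d_Q^{−2δ}`. -/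
theorem stmt14 (d : ℕ) (σ δ C₀ C₁ κ : ℝ) (hσ : 0 < σ) (hδ : 0 ≤ δ) (hδσ : δ < σ)
    (hC₀ : 0 < C₀) (hC₁ : 0 < C₁) (hκ : 1 < κ) :
    ∃ C > 0,
      ∀ V : Rd d → ℝ, LocallyIntegrable V volume → (∀ u, 0 ≤ V u) →
      ∀ T : ℝ → Rd d → Rd d → ℝ,
        (Measurable fun p : ℝ × Rd d × Rd d => T p.1 p.2.1 p.2.2) →
        -- (i) 0 ≤ T_t ≤ H_t
        (∀ t > 0, ∀ x y : Rd d, 0 ≤ T t x y ∧ T t x y ≤ heatK d t x y) →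
        -- (ii) the perturbation formula
        (∀ t > 0, ∀ x y : Rd d,
          heatK d t x y - T t x y =
            ∫ s in Set.Ioc (0 : ℝ) t, ∫ u, heatK d (t - s) x u * V u * T s u y) →
      ∀ (z : Rd d) (r : Fin d → ℝ), (∀ i, 0 < r i) → (∀ i j, r i ≤ C₁ * r j) →
        -- condition (K)
        (∀ y : Rd d, ∀ t ∈ Set.Ioc (0 : ℝ) (diam (cuboid univ z r) ^ 2),
          (∫⁻ s in Set.Ioc (0 : ℝ) t, ∫⁻ x in cuboidSt univ z r κ 3,
              ENNReal.ofReal (heatK d s x y * V x))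
            ≤ ENNReal.ofReal (C₀ * (t / diam (cuboid univ z r) ^ 2) ^ σ)) →
        -- (iii) the tail estimate
        (∀ y ∈ cuboidSt univ z r κ 1,
          (∫⁻ u in univ \ cuboidSt univ z r κ 3,
              ∫⁻ s in Set.Ioi (0 : ℝ), ENNReal.ofReal (V u * T s u y))
            ≤ ENNReal.ofReal C₀) →
      ∀ y ∈ cuboidSt univ z r κ 1,
        (∫⁻ x in cuboidSt univ z r κ 2,
            ⨆ (t : ℝ) (_ : 0 < t) (_ : t ≤ diam (cuboid univ z r) ^ 2),
              ENNReal.ofReal (t ^ (-δ) * (heatK d t x y - T t x y)))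
          ≤ ENNReal.ofReal (C * diam (cuboid univ z r) ^ (-(2 * δ))) := by
  rcases Nat.eq_zero_or_pos d with rfl | hd
  · refine ⟨1, one_pos, ?_⟩
    intro V _ _ T _ _ _ z r _ _ _ _ y _
    have h0 : diam (cuboid univ z r) = 0 := diam_subsingleton (subsingleton_of_subsingleton)
    refine le_trans (le_of_eq ?_) zero_le
    rw [h0]
    have : ∀ x : Rd 0, (⨆ (t : ℝ) (_ : 0 < t) (_ : t ≤ (0 : ℝ) ^ 2),
        ENNReal.ofReal (t ^ (-δ) * (heatK 0 t x y - T t x y))) = 0 := fun x => by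
      simp only [ENNReal.iSup_eq_zero]
      intro t ht ht'
      norm_num at ht'
      linarith
    simp only [this, lintegral_zero]
  have hd' : (0 : ℝ) < d := by exact_mod_cast hd
  have hκ0 : 0 < κ := by linarith
  have hκ' : 0 < κ ^ 3 - κ ^ 2 := by
    have := pow_lt_pow_right₀ hκ (show 2 < 3 by norm_num)
    linarith
  obtain ⟨Cn, hCn, near⟩ :=
    exists_duhamel_majorant d (d * (κ ^ 3 + κ)) hδ hδσ hC₀
  obtain ⟨K, hK0, far⟩ := exists_heatK_off_diagonal_bound hd hδ
    (show 0 < (κ ^ 3 - κ ^ 2) / (2 * d * C₁) by positivity)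
  set v : ℝ := (volume (ball (0 : Rd d) 1)).toReal with hv
  refine ⟨Cn + K * C₀ * ((d * κ ^ 2) ^ d * v), by positivity, ?_⟩
  intro V hV hV0 T hT hTH hpert z r hr hrC hK htail y hy
  set D := diam (cuboid univ z r) with hD
  have hD0 : 0 < D := (hr ⟨0, hd⟩).trans_le (side_le_diam_cuboid z hr _)
  set Q₂ := cuboidSt univ z r κ 2
  set Q₃ := cuboidSt univ z r κ 3
  have hQ₂ : MeasurableSet Q₂ := measurableSet_cuboid _ _
  have hQ₃ : MeasurableSet Q₃ := measurableSet_cuboid _ _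
  have hVm : AEMeasurable (fun u => ENNReal.ofReal (V u)) (volume : Measure (Rd d)) :=
    hV.aestronglyMeasurable.aemeasurable.ennreal_ofReal
  set μ : Measure (Rd d) := volume.withDensity fun u => ENNReal.ofReal (V u)
  let τ : ℝ → Rd d → ℝ≥0∞ := fun s u => ENNReal.ofReal (T s u y)
  have hτ : Measurable fun p : ℝ × Rd d => τ p.1 p.2 :=
    (hT.comp (f := fun p : ℝ × Rd d => (p.1, p.2, y)) (by fun_prop)).ennreal_ofReal
  have hτs : ∀ s, Measurable (τ s) := fun s => hτ.comp measurable_prodMk_left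
  obtain ⟨F, hFm, hF, hFint⟩ := near D (μ.restrict Q₃) y hD0 (by
      refine (ae_restrict_iff' hQ₃).2 (Eventually.of_forall fun u hu => ?_)
      rw [mul_assoc]
      refine dist_le_card_mul (by positivity) fun i => ?_
      refine (abs_coord_sub_le_add (hu.2 i) (hy.2 i)).trans ?_
      rw [← add_mul, pow_one]
      gcongr
      exact side_le_diam_cuboid z hr i) (fun t ht => by
      refine le_trans (le_of_eq ?_) (hK y t ht)
      refine lintegral_congr fun s => ?_
      rw [setLIntegral_withDensity_eq_lintegral_mul₀ hVm (by fun_prop) hQ₃]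
      refine lintegral_congr fun u => ?_
      rw [Pi.mul_apply, ENNReal.ofReal_mul' (hV0 u), heatE, mul_comm])
  have htail' : ∀ t, ∫⁻ s in Ioc 0 t, ∫⁻ u in Q₃ᶜ, τ s u ∂μ ≤ ENNReal.ofReal C₀ := fun t => by
    refine (lintegral_mono_set Ioc_subset_Ioi_self).trans ?_
    rw [lintegral_lintegral_swap hτ.aemeasurable,
      setLIntegral_withDensity_eq_lintegral_mul₀ hVm
        (Measurable.aemeasurable hτ.lintegral_prod_left') hQ₃.compl]
    refine le_trans (le_of_eq ?_) (htail y hy)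
    rw [← compl_eq_univ_sdiff]
    refine lintegral_congr fun u => ?_
    rw [Pi.mul_apply, ← lintegral_const_mul' _ _ ENNReal.ofReal_ne_top]
    exact lintegral_congr fun s => (ENNReal.ofReal_mul (hV0 u)).symm
  have hsplit : ∀ t > 0, ∀ x, ENNReal.ofReal (heatK d t x y - T t x y) ≤
      (∫⁻ s in Ioc 0 t, ∫⁻ u in Q₃, heatE d (t - s) x u * heatE d s u y ∂μ) +
        ∫⁻ s in Ioc 0 t, ∫⁻ u in Q₃ᶜ, heatE d (t - s) x u * τ s u ∂μ := fun t ht x => by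
    rw [hpert t ht x y]
    refine (ofReal_integral_integral_le _ _ _).trans ?_
    rw [← lintegral_add_left (Measurable.lintegral_prod_right' (f := fun p : ℝ × Rd d =>
          heatE d (t - p.1) x p.2 * heatE d p.1 p.2 y) (by fun_prop))]
    refine setLIntegral_mono' measurableSet_Ioc fun s hs => ?_
    have e : ∫⁻ u, ‖heatK d (t - s) x u * V u * T s u y‖ₑ =
        ∫⁻ u, heatE d (t - s) x u * τ s u ∂μ := by
      rw [lintegral_withDensity_eq_lintegral_mul₀ hVm (g := fun u => heatE d (t - s) x u * τ s u)
        (Measurable.aemeasurable (Measurable.mul (by fun_prop) (hτs s)))]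
      refine lintegral_congr fun u => ?_
      have h1 := heatK_nonneg d (sub_nonneg.2 hs.2) x u
      have h2 := (hTH s hs.1 u y).1
      rw [Real.enorm_of_nonneg (mul_nonneg (mul_nonneg h1 (hV0 u)) h2), ENNReal.ofReal_mul' h2,
        ENNReal.ofReal_mul' (hV0 u), Pi.mul_apply, heatE]
      ring
    rw [e, ← lintegral_add_compl _ hQ₃]
    gcongr with u
    exact ENNReal.ofReal_le_ofReal (hTH s hs.1 u y).2
  have hfar : ∀ x ∈ Q₂, ∀ t > 0, ENNReal.ofReal (t ^ (-δ)) *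
      ∫⁻ s in Ioc 0 t, ∫⁻ u in Q₃ᶜ, heatE d (t - s) x u * τ s u ∂μ ≤
        ENNReal.ofReal (K * D ^ (-(2 * δ) - d) * C₀) := fun x hx t ht => by
    rw [ENNReal.ofReal_mul (by positivity)]
    refine le_trans ?_ (mul_le_mul_right (htail' t) _)
    rw [← lintegral_const_mul' _ _ ENNReal.ofReal_ne_top,
      ← lintegral_const_mul' _ _ ENNReal.ofReal_ne_top]
    refine setLIntegral_mono' measurableSet_Ioc fun s hs => ?_
    rw [← lintegral_const_mul' _ _ ENNReal.ofReal_ne_top,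
      ← lintegral_const_mul' _ _ ENNReal.ofReal_ne_top]
    refine setLIntegral_mono' hQ₃.compl fun u hu => ?_
    rw [← mul_assoc, heatE, ← ENNReal.ofReal_mul (by positivity)]
    exact mul_le_mul' (ENNReal.ofReal_le_ofReal (far D t s x u hD0 ht hs
      (le_dist_of_notMem_cuboidSt hC₁ hκ hr hrC hx hu))) le_rfl
  have hvol : volume Q₂ ≤ ENNReal.ofReal ((d * κ ^ 2) ^ d * v * D ^ d) := by
    have hsub : Q₂ ⊆ closedBall z (d * κ ^ 2 * D) := fun x hx => by
      rw [mem_closedBall, mul_assoc]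
      refine dist_le_card_mul (by positivity) fun i => (hx.2 i).trans ?_
      exact mul_le_mul_of_nonneg_left (side_le_diam_cuboid z hr i) (by positivity)
    refine (measure_mono hsub).trans ?_
    rw [Measure.addHaar_closedBall _ _ (by positivity), finrank_euclideanSpace, Fintype.card_fin,
      ← ENNReal.ofReal_toReal (measure_ball_lt_top (x := (0 : Rd d)) (r := 1)).ne,
      ← ENNReal.ofReal_mul (by positivity), ← hv]
    refine ENNReal.ofReal_le_ofReal (le_of_eq ?_)
    ring
  calc _ ≤ ∫⁻ x in Q₂, (F x + ENNReal.ofReal (K * D ^ (-(2 * δ) - d) * C₀)) := by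
        refine setLIntegral_mono' hQ₂ fun x hx => iSup_le fun t => iSup_le fun ht => iSup_le
          fun htD => ?_
        rw [ENNReal.ofReal_mul (by positivity)]
        refine (mul_le_mul_right (hsplit t ht x) _).trans ?_
        rw [mul_add]
        exact add_le_add (hF x t ⟨ht, htD⟩) (hfar x hx t ht)
    _ = (∫⁻ x in Q₂, F x) + ENNReal.ofReal (K * D ^ (-(2 * δ) - d) * C₀) * volume Q₂ := by
        rw [lintegral_add_left hFm, setLIntegral_const]
    _ ≤ ENNReal.ofReal (Cn * D ^ (-(2 * δ))) + ENNReal.ofReal (K * D ^ (-(2 * δ) - d) * C₀) *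
          ENNReal.ofReal ((d * κ ^ 2) ^ d * v * D ^ d) := by
        gcongr
        exact (setLIntegral_le_lintegral _ _).trans hFint
    _ = _ := by
        rw [← ENNReal.ofReal_mul (by positivity),
          ← ENNReal.ofReal_add (by positivity) (by positivity), Real.rpow_sub hD0,
          Real.rpow_natCast]
        congr 1
        field_simp
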